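/- arXiv:1807.00372 — 5 statements merged into one kernel-verified Lean document; each statement's English description precedes it below -/
import Mathlib

section
/- Let N > 0, X¹, X², X³ ∈ ℝ, let ξ₂, ξ₃ ∈ ℝ with (ξ₂, ξ₃) ≠ (0,0), and let z ∈ ℂ satisfy N²(z² + ξ₂² + ξ₃²) = (zX¹ + ξ₂X² + ξ₃X³)². Let B̂(z, ξ₂, ξ₃) be the 8×8 complex matrix with S = zX¹ + ξ₂X² + ξ₃X³ and rows: Row1 = (0, 0, 0, 0, 0, 0, −ξ₂, −ξ₃); Row2 = (0, 0, 0, ξ₂, ξ₃, 0, 0, 0); Row3 = (−2N²ξ₂, 0, 0, z, 0, 0, zX¹+ξ₃X³, −ξ₂X³); Row4 = (−2N²ξ₃, 0, 0, 0, z, 0, −ξ₃X², zX¹+ξ₂X²); Row5 = (0, z, 2S, 0, 0, 2N²z, −2SX², −2SX³); Row6 = (0, ξ₂, 0, 2S, 0, 0, 2N²z, 0); Row7 = (0, ξ₃, 0, 0, 2S, 0, 0, 2N²z); Row8 = (0, S, N²z+SX¹, SX², SX³, N²S+N²zX¹, 0, 0). Then det B̂(z, ξ₂, ξ₃) = 8N⁸(ξ₂²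 + ξ₃²)⁴; in particular det B̂(z, ξ₂, ξ₃) ≠ 0, so B̂(z, ξ₂, ξ₃) is invertible. -/
lemma det_six (n X Y Z a b z S p q : ℂ) (hp : p = z * X + b * Z) (hq : q = z * X + a * Y)
    (hS : S = z * X + a * Y + b * Z) :
    Matrix.det !![0, 0, 0, 0, -a, -b;
       0, 0, a, b, 0, 0;
       -2*n*a, 0, z, 0, p, -a*Z;
       -2*n*b, 0, 0, z, -b*Y, q;
       0, a, 2*S, 0, 2*n*z, 0;
       0, b, 0, 2*S, 0, 2*n*z] =
     4 * n * (a^2+b^2)^2 * (S^2 - n * z^2) := by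
  rw [Matrix.det_succ_row_zero]
  simp [Fin.sum_univ_succ, Fin.succAbove, Matrix.submatrix]
  simp only [Matrix.det_succ_row_zero (n := 4)]
  simp [Fin.sum_univ_succ, Fin.succAbove, Matrix.submatrix]
  simp only [Matrix.det_succ_row_zero (n := 3)]
  simp [Fin.sum_univ_succ, Fin.succAbove, Matrix.submatrix]
  simp only [Matrix.det_succ_row_zero (n := 2)]
  simp [Fin.sum_univ_succ, Fin.succAbove, Matrix.submatrix]
  simp [Matrix.det_fin_two]
  subst hp hq hS
  ring

lemma det_eight (n Y Z a b z S p q t u v w r s : ℂ) :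
    Matrix.det !![0, 0, 0, 0, 0, 0, -a, -b;
       0, 0, 0, a, b, 0, 0, 0;
       -2*n*a, 0, 0, z, 0, 0, p, -a*Z;
       -2*n*b, 0, 0, 0, z, 0, -b*Y, q;
       0, z, u, 0, 0, v, r, s;
       0, a, 0, 2*S, 0, 0, 2*n*z, 0;
       0, b, 0, 0, 2*S, 0, 0, 2*n*z;
       0, S, w, S*Y, S*Z, t, 0, 0] =
     (1) * (u) * Matrix.det !![0, 0, 0, 0, 0, -a, -b;
       0, 0, a, b, 0, 0, 0;
       -2*n*a, 0, z, 0, 0, p, -a*Z;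
       -2*n*b, 0, 0, z, 0, -b*Y, q;
       0, a, 2*S, 0, 0, 2*n*z, 0;
       0, b, 0, 2*S, 0, 0, 2*n*z;
       0, S, S*Y, S*Z, t, 0, 0] + (-1) * (w) * Matrix.det !![0, 0, 0, 0, 0, -a, -b;
       0, 0, a, b, 0, 0, 0;
       -2*n*a, 0, z, 0, 0, p, -a*Z;
       -2*n*b, 0, 0, z, 0, -b*Y, q;
       0, z, 0, 0, v, r, s;
       0, a, 2*S, 0, 0, 2*n*z, 0;
       0, b, 0, 2*S, 0, 0, 2*n*z] := by
  rw [Matrix.det_succ_column _ 2]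
  have e0 : Matrix.submatrix !![0, 0, 0, 0, 0, 0, -a, -b;
       0, 0, 0, a, b, 0, 0, 0;
       -2*n*a, 0, 0, z, 0, 0, p, -a*Z;
       -2*n*b, 0, 0, 0, z, 0, -b*Y, q;
       0, z, u, 0, 0, v, r, s;
       0, a, 0, 2*S, 0, 0, 2*n*z, 0;
       0, b, 0, 0, 2*S, 0, 0, 2*n*z;
       0, S, w, S*Y, S*Z, t, 0, 0]
      (Fin.succAbove (4 : Fin 8)) (Fin.succAbove (2 : Fin 8)) = !![0, 0, 0, 0, 0, -a, -b;
       0, 0, a, b, 0, 0, 0;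
       -2*n*a, 0, z, 0, 0, p, -a*Z;
       -2*n*b, 0, 0, z, 0, -b*Y, q;
       0, a, 2*S, 0, 0, 2*n*z, 0;
       0, b, 0, 2*S, 0, 0, 2*n*z;
       0, S, S*Y, S*Z, t, 0, 0] := by
    ext i j; fin_cases i <;> fin_cases j <;> rfl
  have e1 : Matrix.submatrix !![0, 0, 0, 0, 0, 0, -a, -b;
       0, 0, 0, a, b, 0, 0, 0;
       -2*n*a, 0, 0, z, 0, 0, p, -a*Z;
       -2*n*b, 0, 0, 0, z, 0, -b*Y, q;
       0, z, u, 0, 0, v, r, s;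
       0, a, 0, 2*S, 0, 0, 2*n*z, 0;
       0, b, 0, 0, 2*S, 0, 0, 2*n*z;
       0, S, w, S*Y, S*Z, t, 0, 0]
      (Fin.succAbove (7 : Fin 8)) (Fin.succAbove (2 : Fin 8)) = !![0, 0, 0, 0, 0, -a, -b;
       0, 0, a, b, 0, 0, 0;
       -2*n*a, 0, z, 0, 0, p, -a*Z;
       -2*n*b, 0, 0, z, 0, -b*Y, q;
       0, z, 0, 0, v, r, s;
       0, a, 2*S, 0, 0, 2*n*z, 0;
       0, b, 0, 2*S, 0, 0, 2*n*z] := by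
    ext i j; fin_cases i <;> fin_cases j <;> rfl
  rw [Fin.sum_univ_eight]
  rw [e0, e1]
  simp [pow_succ]

lemma det_sevA (n Y Z a b z S p q t : ℂ) :
    Matrix.det !![0, 0, 0, 0, 0, -a, -b;
       0, 0, a, b, 0, 0, 0;
       -2*n*a, 0, z, 0, 0, p, -a*Z;
       -2*n*b, 0, 0, z, 0, -b*Y, q;
       0, a, 2*S, 0, 0, 2*n*z, 0;
       0, b, 0, 2*S, 0, 0, 2*n*z;
       0, S, S*Y, S*Z, t, 0, 0] =
     (1) * (t) * Matrix.det !![0, 0, 0, 0, -a, -b;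
       0, 0, a, b, 0, 0;
       -2*n*a, 0, z, 0, p, -a*Z;
       -2*n*b, 0, 0, z, -b*Y, q;
       0, a, 2*S, 0, 2*n*z, 0;
       0, b, 0, 2*S, 0, 2*n*z] := by
  rw [Matrix.det_succ_column _ 4]
  have e0 : Matrix.submatrix !![0, 0, 0, 0, 0, -a, -b;
       0, 0, a, b, 0, 0, 0;
       -2*n*a, 0, z, 0, 0, p, -a*Z;
       -2*n*b, 0, 0, z, 0, -b*Y, q;
       0, a, 2*S, 0, 0, 2*n*z, 0;
       0, b, 0, 2*S, 0, 0, 2*n*z;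
       0, S, S*Y, S*Z, t, 0, 0]
      (Fin.succAbove (6 : Fin 7)) (Fin.succAbove (4 : Fin 7)) = !![0, 0, 0, 0, -a, -b;
       0, 0, a, b, 0, 0;
       -2*n*a, 0, z, 0, p, -a*Z;
       -2*n*b, 0, 0, z, -b*Y, q;
       0, a, 2*S, 0, 2*n*z, 0;
       0, b, 0, 2*S, 0, 2*n*z] := by
    ext i j; fin_cases i <;> fin_cases j <;> rfl
  rw [Fin.sum_univ_seven]
  rw [e0]
  simp [pow_succ]

lemma det_sevB (n Y Z a b z S p q v r s : ℂ) :
    Matrix.det !![0, 0, 0, 0, 0, -a, -b;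
       0, 0, a, b, 0, 0, 0;
       -2*n*a, 0, z, 0, 0, p, -a*Z;
       -2*n*b, 0, 0, z, 0, -b*Y, q;
       0, z, 0, 0, v, r, s;
       0, a, 2*S, 0, 0, 2*n*z, 0;
       0, b, 0, 2*S, 0, 0, 2*n*z] =
     (1) * (v) * Matrix.det !![0, 0, 0, 0, -a, -b;
       0, 0, a, b, 0, 0;
       -2*n*a, 0, z, 0, p, -a*Z;
       -2*n*b, 0, 0, z, -b*Y, q;
       0, a, 2*S, 0, 2*n*z, 0;
       0, b, 0, 2*S, 0, 2*n*z] := by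
  rw [Matrix.det_succ_column _ 4]
  have e0 : Matrix.submatrix !![0, 0, 0, 0, 0, -a, -b;
       0, 0, a, b, 0, 0, 0;
       -2*n*a, 0, z, 0, 0, p, -a*Z;
       -2*n*b, 0, 0, z, 0, -b*Y, q;
       0, z, 0, 0, v, r, s;
       0, a, 2*S, 0, 0, 2*n*z, 0;
       0, b, 0, 2*S, 0, 0, 2*n*z]
      (Fin.succAbove (4 : Fin 7)) (Fin.succAbove (4 : Fin 7)) = !![0, 0, 0, 0, -a, -b;
       0, 0, a, b, 0, 0;
       -2*n*a, 0, z, 0, p, -a*Z;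
       -2*n*b, 0, 0, z, -b*Y, q;
       0, a, 2*S, 0, 2*n*z, 0;
       0, b, 0, 2*S, 0, 2*n*z] := by
    ext i j; fin_cases i <;> fin_cases j <;> rfl
  rw [Fin.sum_univ_seven]
  rw [e0]
  simp [pow_succ]

/-- The complementing (Agmon–Douglis–Nirenberg) boundary condition: at a
root `z` of the interior principal symbol, i.e. `N²(z² + ξ₂² + ξ₃²) = (zX¹+ξ₂X²+ξ₃X³)²`,
with `(ξ₂,ξ₃) ≠ (0,0)`, the reduced boundary symbol matrix `B̂(z,ξ₂,ξ₃)` has determinant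
`8N⁸(ξ₂² + ξ₃²)⁴ ≠ 0` and hence is invertible. -/
theorem stmt_3 (N X1 X2 X3 : ℝ) (hN : 0 < N) (ξ₂ ξ₃ : ℝ) (hξ : (ξ₂, ξ₃) ≠ (0, 0))
    (z : ℂ)
    (hz : (N : ℂ)^2 * (z^2 + (ξ₂ : ℂ)^2 + (ξ₃ : ℂ)^2) =
      (z * (X1 : ℂ) + (ξ₂ : ℂ) * (X2 : ℂ) + (ξ₃ : ℂ) * (X3 : ℂ))^2)
    (S : ℂ) (hS : S = z * (X1 : ℂ) + (ξ₂ : ℂ) * (X2 : ℂ) + (ξ₃ : ℂ) * (X3 : ℂ))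
    (B : Matrix (Fin 8) (Fin 8) ℂ)
    (hB : B = !![0, 0, 0, 0, 0, 0, -(ξ₂:ℂ), -(ξ₃:ℂ);
                 0, 0, 0, (ξ₂:ℂ), (ξ₃:ℂ), 0, 0, 0;
                 -2*(N:ℂ)^2*(ξ₂:ℂ), 0, 0, z, 0, 0, z*(X1:ℂ) + (ξ₃:ℂ)*(X3:ℂ), -(ξ₂:ℂ)*(X3:ℂ);
                 -2*(N:ℂ)^2*(ξ₃:ℂ), 0, 0, 0, z, 0, -(ξ₃:ℂ)*(X2:ℂ), z*(X1:ℂ) + (ξ₂:ℂ)*(X2:ℂ);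
                 0, z, 2*S, 0, 0, 2*(N:ℂ)^2*z, -2*S*(X2:ℂ), -2*S*(X3:ℂ);
                 0, (ξ₂:ℂ), 0, 2*S, 0, 0, 2*(N:ℂ)^2*z, 0;
                 0, (ξ₃:ℂ), 0, 0, 2*S, 0, 0, 2*(N:ℂ)^2*z;
                 0, S, (N:ℂ)^2*z + S*(X1:ℂ), S*(X2:ℂ), S*(X3:ℂ),
                   (N:ℂ)^2*S + (N:ℂ)^2*z*(X1:ℂ), 0, 0]) :
    B.det = 8 * (N : ℂ)^8 * ((ξ₂ : ℂ)^2 + (ξ₃ : ℂ)^2)^4 ∧ B.det ≠ 0 ∧ IsUnit B := by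
  have hdet : B.det = 8 * ((N:ℂ)^2)^2 * ((ξ₂ : ℂ)^2 + (ξ₃ : ℂ)^2)^2 * (S^2 - (N:ℂ)^2 * z^2)^2 := by
    rw [hB]
    rw [det_eight, det_sevA, det_sevB, det_six ((N:ℂ)^2) X1 X2 X3 ξ₂ ξ₃ z S _ _ rfl rfl hS]
    ring
  have h1 : S^2 - (N:ℂ)^2 * z^2 = (N:ℂ)^2 * ((ξ₂ : ℂ)^2 + (ξ₃ : ℂ)^2) := by
    rw [hS, ← hz]; ring
  have h2 : B.det = 8 * (N : ℂ)^8 * ((ξ₂ : ℂ)^2 + (ξ₃ : ℂ)^2)^4 := by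
    rw [hdet, h1]; ring
  have hq : ξ₂^2 + ξ₃^2 ≠ 0 := by
    intro h
    apply hξ
    have ha : ξ₂ = 0 := by nlinarith [sq_nonneg ξ₂, sq_nonneg ξ₃]
    have hb : ξ₃ = 0 := by nlinarith [sq_nonneg ξ₂, sq_nonneg ξ₃]
    rw [ha, hb]
  have hqc : (ξ₂ : ℂ)^2 + (ξ₃ : ℂ)^2 ≠ 0 := by exact_mod_cast hq
  have hNc : (N : ℂ) ≠ 0 := by exact_mod_cast hN.ne'
  have h3 : B.det ≠ 0 := by
    rw [h2]
    exact mul_ne_zero (mul_ne_zero (by norm_num) (pow_ne_zero _ hNc)) (pow_ne_zero _ hqc)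
  exact ⟨h2, h3, (Matrix.isUnit_iff_isUnit_det B).2 (isUnit_iff_ne_zero.2 h3)⟩
end

section
/- Let N, X¹, X², X³, ξ₁, ξ₂, ξ₃ be complex numbers and set S = ξ₁X¹ + ξ₂X² + ξ₃X³. Let C be the 8×8 matrix with rows: Row1 = (0, 0, 0, 0, 0, 0, 2N²ξ₂, 2N²ξ₃); Row2 = (0, 0, 0, 2Nξ₂, 2Nξ₃, 0, −2Nξ₂X¹, −2Nξ₃X¹); Row3 = (−2N³ξ₂, 0, Nξ₂, Nξ₁, 0, −Nξ₂X¹, Nξ₃X³, −Nξ₂X³); Row4 = (−2N³ξ₃, 0, Nξ₃, 0, Nξ₁, −Nξ₃X¹, −Nξ₃X², Nξ₂X²); Row5 = (0, ξ₁, 2S−2ξ₁X¹, −2ξ₁X², −2ξ₁X³, ξ₁X¹X¹+N²ξ₁−2SX¹, ξ₁X¹X²−2SX²+2N²ξ₂, ξ₁X¹X³−2SX³+2N²ξ₃); Row6 = (0, ξ₂, −2ξ₂X¹, 2S−2ξ₂X², −2ξ₂X³, ξ₂X¹X¹−N²ξ₂, ξ₂X¹X²−2SX¹+2N²ξ₁,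 ξ₂X¹X³); Row7 = (0, ξ₃, −2ξ₃X¹, −2ξ₃X², 2S−2ξ₃X³, ξ₃X¹X¹−N²ξ₃, ξ₃X¹X², ξ₃X¹X³−2SX¹+2N²ξ₁); Row8 = (0, 2S, 2(N²ξ₁−SX¹), 2(N²ξ₂−SX²), 2(N²ξ₃−SX³), 0, 0, 0). Then det C = −64N⁹(N²ξ₁² − S²)²(ξ₂² + ξ₃²)². Consequently, if N ≠ 0, the matrix B̃ = −(1/(2N²))·C satisfies det B̃ = −(1/(4N⁷))(N²ξ₁² − S²)²(ξ₂² + ξ₃²)². -/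
set_option maxHeartbeats 4000000 in
theorem det_reduced (N X Y Z a b c S : ℂ) (hS : S = a * X + b * Y + c * Z) :
    (!![0, 0, 0, 0, 0, 0, 2*N^2*b, 2*N^2*c;
        0, 0, 0, 2*N*b, 2*N*c, 0, 0, 0;
        -2*N^3*b, 0, N*b, N*a, 0, 0, N*c*Z+N*a*X, -N*b*Z;
        -2*N^3*c, 0, N*c, 0, N*a, 0, -N*c*Y, N*b*Y+N*a*X;
        0, a, 2*S, 0, 0, N^2*a, 2*N^2*b-2*S*Y, 2*N^2*c-2*S*Z;
        0, b, 0, 2*S, 0, -N^2*b, 2*N^2*a, 0;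
        0, c, 0, 0, 2*S, -N^2*c, 0, 2*N^2*a;
        0, 2*S, 2*N^2*a+2*S*X, 2*N^2*b+2*S*Y, 2*N^2*c+2*S*Z, 2*N^2*a*X, 2*N^2*b*X, 2*N^2*c*X]
      : Matrix (Fin 8) (Fin 8) ℂ).det
      = -64 * N^9 * (N^2 * a^2 - S^2)^2 * (b^2 + c^2)^2 := by
  simp [Matrix.det_succ_row_zero, Fin.sum_univ_succ, Fin.succAbove]
  subst hS
  ring

theorem det_unip (X Y Z : ℂ) :
    (!![1, 0, 0, 0, 0, 0, 0, 0;
        0, 1, 2*X, 2*Y, 2*Z, X^2, X*Y, X*Z;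
        0, 0, 1, 0, 0, X, 0, 0;
        0, 0, 0, 1, 0, 0, X, 0;
        0, 0, 0, 0, 1, 0, 0, X;
        0, 0, 0, 0, 0, 1, 0, 0;
        0, 0, 0, 0, 0, 0, 1, 0;
        0, 0, 0, 0, 0, 0, 0, 1] : Matrix (Fin 8) (Fin 8) ℂ).det = 1 := by
  rw [Matrix.det_of_isUpperTriangular]
  · simp [Fin.prod_univ_succ]
  · intro i j h
    fin_cases i <;> fin_cases j <;> first | rfl | (exfalso; revert h; decide)

set_option maxHeartbeats 4000000 in

/-- Determinant of the full boundary symbol matrix.  For the matrix `C`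
below (so that `B̃ = −(1/(2N²))·C` is the full principal symbol matrix of the linearized
Bartnik-plus-gauge boundary conditions), `det C = −64N⁹(N²ξ₁² − S²)²(ξ₂² + ξ₃²)²`, and
consequently, when `N ≠ 0`, `det B̃ = −(1/(4N⁷))(N²ξ₁² − S²)²(ξ₂² + ξ₃²)²`.  Here
`S = ξ₁X¹ + ξ₂X² + ξ₃X³`, and the identity holds for all complex parameters. -/
theorem stmt_4 (N X1 X2 X3 ξ₁ ξ₂ ξ₃ S : ℂ) (hS : S = ξ₁ * X1 + ξ₂ * X2 + ξ₃ * X3)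
    (C : Matrix (Fin 8) (Fin 8) ℂ)
    (hC : C = !![0, 0, 0, 0, 0, 0, 2*N^2*ξ₂, 2*N^2*ξ₃;
                 0, 0, 0, 2*N*ξ₂, 2*N*ξ₃, 0, -2*N*ξ₂*X1, -2*N*ξ₃*X1;
                 -2*N^3*ξ₂, 0, N*ξ₂, N*ξ₁, 0, -N*ξ₂*X1, N*ξ₃*X3, -N*ξ₂*X3;
                 -2*N^3*ξ₃, 0, N*ξ₃, 0, N*ξ₁, -N*ξ₃*X1, -N*ξ₃*X2, N*ξ₂*X2;
                 0, ξ₁, 2*S - 2*ξ₁*X1, -2*ξ₁*X2, -2*ξ₁*X3,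
                   ξ₁*X1*X1 + N^2*ξ₁ - 2*S*X1, ξ₁*X1*X2 - 2*S*X2 + 2*N^2*ξ₂,
                   ξ₁*X1*X3 - 2*S*X3 + 2*N^2*ξ₃;
                 0, ξ₂, -2*ξ₂*X1, 2*S - 2*ξ₂*X2, -2*ξ₂*X3,
                   ξ₂*X1*X1 - N^2*ξ₂, ξ₂*X1*X2 - 2*S*X1 + 2*N^2*ξ₁, ξ₂*X1*X3;
                 0, ξ₃, -2*ξ₃*X1, -2*ξ₃*X2, 2*S - 2*ξ₃*X3,
                   ξ₃*X1*X1 - N^2*ξ₃, ξ₃*X1*X2, ξ₃*X1*X3 - 2*S*X1 + 2*N^2*ξ₁;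
                 0, 2*S, 2*(N^2*ξ₁ - S*X1), 2*(N^2*ξ₂ - S*X2), 2*(N^2*ξ₃ - S*X3),
                   0, 0, 0]) :
    C.det = -64 * N^9 * (N^2 * ξ₁^2 - S^2)^2 * (ξ₂^2 + ξ₃^2)^2 ∧
      (N ≠ 0 → ((-(1 / (2 * N^2))) • C).det =
        -(1 / (4 * N^7)) * (N^2 * ξ₁^2 - S^2)^2 * (ξ₂^2 + ξ₃^2)^2) := by
  have h1 : C.det = -64 * N^9 * (N^2 * ξ₁^2 - S^2)^2 * (ξ₂^2 + ξ₃^2)^2 := by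
    rw [← det_reduced N X1 X2 X3 ξ₁ ξ₂ ξ₃ S hS, ← mul_one C.det, ← det_unip X1 X2 X3,
      ← Matrix.det_mul]
    congr 1
    rw [hC]
    ext i j
    fin_cases i <;> fin_cases j <;>
      simp [Matrix.mul_apply, Fin.sum_univ_succ] <;> ring
  refine ⟨h1, fun hN => ?_⟩
  rw [Matrix.det_smul, h1, Fintype.card_fin]
  field_simp
  ring
end

section
/- Let t, ξ₁, ξ₂, ξ₃ be complex numbers. Let M_t be the 8×8 matrix with rows: Row1 = (0, 0, 0, 0, 0, tξ₁, −(1−t)ξ₂, −(1−t)ξ₃); Row2 = (−tξ₁, 0, 0, (1−t)ξ₂, (1−t)ξ₃, 0, 0, 0); Row3 = (−2(1−t)ξ₂, 0, (1−t)ξ₂, ξ₁, 0, 0, 0, 0); Row4 = (−2(1−t)ξ₃, 0, (1−t)ξ₃, 0, ξ₁, 0, 0, 0); Row5 = (0, ξ₁, 0, 0, 0, (1−t)ξ₁, 2(1−t)ξ₂, 2(1−t)ξ₃); Row6 = (0, (1−t)ξ₂, 0, 0, 0, −(1−t)ξ₂, 2ξ₁, 0); Row7 = (0, (1−t)ξ₃,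 0, 0, 0, −(1−t)ξ₃, 0, 2ξ₁); Row8 = (0, 0, ξ₁, (1−t)ξ₂, (1−t)ξ₃, 0, 0, 0). Then det M_t = −[tξ₁⁴ − (2+t)(1−t)²ξ₁²(ξ₂²+ξ₃²)]·[2(2+t)(1−t)²(ξ₂²+ξ₃²)ξ₁² − 4tξ₁⁴], i.e. det M_t = 2ξ₁⁴·[(2+t)(1−t)²(ξ₂²+ξ₃²) − tξ₁²]·[(2+t)(1−t)²(ξ₂²+ξ₃²) − 2tξ₁²]. -/
set_option maxHeartbeats 4000000 in
/-- Determinant of the principal symbol matrix `M_t` of the boundary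
operator `DB_t` in the homotopy of boundary conditions at the flat metric:
`det M_t = −[tξ₁⁴ − (2+t)(1−t)²ξ₁²(ξ₂²+ξ₃²)]·[2(2+t)(1−t)²(ξ₂²+ξ₃²)ξ₁² − 4tξ₁⁴]`,
i.e. `det M_t = 2ξ₁⁴[(2+t)(1−t)²(ξ₂²+ξ₃²) − tξ₁²][(2+t)(1−t)²(ξ₂²+ξ₃²) − 2tξ₁²]`,
as a polynomial identity in the complex parameters `t, ξ₁, ξ₂, ξ₃`. -/
theorem stmt_5 (t ξ₁ ξ₂ ξ₃ : ℂ) (M : Matrix (Fin 8) (Fin 8) ℂ)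
    (hM : M = !![0, 0, 0, 0, 0, t*ξ₁, -(1-t)*ξ₂, -(1-t)*ξ₃;
                 -t*ξ₁, 0, 0, (1-t)*ξ₂, (1-t)*ξ₃, 0, 0, 0;
                 -2*(1-t)*ξ₂, 0, (1-t)*ξ₂, ξ₁, 0, 0, 0, 0;
                 -2*(1-t)*ξ₃, 0, (1-t)*ξ₃, 0, ξ₁, 0, 0, 0;
                 0, ξ₁, 0, 0, 0, (1-t)*ξ₁, 2*(1-t)*ξ₂, 2*(1-t)*ξ₃;
                 0, (1-t)*ξ₂, 0, 0, 0, -(1-t)*ξ₂, 2*ξ₁, 0;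
                 0, (1-t)*ξ₃, 0, 0, 0, -(1-t)*ξ₃, 0, 2*ξ₁;
                 0, 0, ξ₁, (1-t)*ξ₂, (1-t)*ξ₃, 0, 0, 0]) :
    M.det = -((t*ξ₁^4 - (2+t)*(1-t)^2*ξ₁^2*(ξ₂^2+ξ₃^2)) *
        (2*(2+t)*(1-t)^2*(ξ₂^2+ξ₃^2)*ξ₁^2 - 4*t*ξ₁^4)) ∧
      M.det = 2*ξ₁^4 * ((2+t)*(1-t)^2*(ξ₂^2+ξ₃^2) - t*ξ₁^2) *
        ((2+t)*(1-t)^2*(ξ₂^2+ξ₃^2) - 2*t*ξ₁^2) := by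
  have h : M.det = 2*ξ₁^4 * ((2+t)*(1-t)^2*(ξ₂^2+ξ₃^2) - t*ξ₁^2) *
        ((2+t)*(1-t)^2*(ξ₂^2+ξ₃^2) - 2*t*ξ₁^2) := by
    subst hM
    simp [Matrix.det_succ_row_zero, Fin.sum_univ_succ, Fin.succAbove, Matrix.submatrix_apply]
    ring
  exact ⟨by rw [h]; ring, h⟩
end

section
/- Let t ∈ [0,1] be real, let ξ₂, ξ₃ ∈ ℝ with (ξ₂, ξ₃) ≠ (0,0), and set ξ₁ = i·√(ξ₂²+ξ₃²) ∈ ℂ. Let M_t be the 8×8 complex matrix with rows: Row1 = (0, 0, 0, 0, 0, tξ₁, −(1−t)ξ₂, −(1−t)ξ₃); Row2 = (−tξ₁, 0, 0, (1−t)ξ₂, (1−t)ξ₃, 0, 0, 0); Row3 = (−2(1−t)ξ₂, 0, (1−t)ξ₂, ξ₁, 0, 0, 0, 0); Row4 = (−2(1−t)ξ₃, 0, (1−t)ξ₃, 0, ξ₁, 0, 0, 0); Row5 = (0, ξ₁, 0, 0, 0, (1−t)ξ₁, 2(1−t)ξ₂, 2(1−t)ξ₃); Row6 = (0, (1−t)ξ₂,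 0, 0, 0, −(1−t)ξ₂, 2ξ₁, 0); Row7 = (0, (1−t)ξ₃, 0, 0, 0, −(1−t)ξ₃, 0, 2ξ₁); Row8 = (0, 0, ξ₁, (1−t)ξ₂, (1−t)ξ₃, 0, 0, 0). Then det M_t = [t + (2+t)(1−t)²]·[2(2+t)(1−t)² + 4t]·(ξ₂²+ξ₃²)⁴, this number is a positive real number, and in particular M_t is invertible for every t ∈ [0,1]. -/
def matA (t a b x : ℂ) : Matrix (Fin 4) (Fin 4) ℂ :=
  !![-t*x, 0, (1-t)*a, (1-t)*b;
     -2*(1-t)*a, (1-t)*a, x, 0;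
     -2*(1-t)*b, (1-t)*b, 0, x;
     0, x, (1-t)*a, (1-t)*b]

def matB (t a b x : ℂ) : Matrix (Fin 4) (Fin 4) ℂ :=
  !![0, t*x, -(1-t)*a, -(1-t)*b;
     x, (1-t)*x, 2*(1-t)*a, 2*(1-t)*b;
     (1-t)*a, -(1-t)*a, 2*x, 0;
     (1-t)*b, -(1-t)*b, 0, 2*x]

theorem detA (t a b x : ℂ) (hx : x^2 = -(a^2+b^2)) :
    (matA t a b x).det = -((t + (2+t)*(1-t)^2) * (a^2+b^2)^2) := by
  have hb : a^2 + b^2 = -x^2 := by rw [hx]; ring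
  have hb2 : b^2 = -x^2 - a^2 := by rw [← hb]; ring
  rw [hb]
  simp [matA, Matrix.det_succ_row_zero, Fin.sum_univ_succ, Fin.succAbove]
  grind

theorem detB (t a b x : ℂ) (hx : x^2 = -(a^2+b^2)) :
    (matB t a b x).det = -((2*(2+t)*(1-t)^2 + 4*t) * (a^2+b^2)^2) := by
  have hb : a^2 + b^2 = -x^2 := by rw [hx]; ring
  have hb2 : b^2 = -x^2 - a^2 := by rw [← hb]; ring
  rw [hb]
  simp [matB, Matrix.det_succ_row_zero, Fin.sum_univ_succ, Fin.succAbove]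
  grind

def rowF : Fin 4 ⊕ Fin 4 → Fin 8 := Sum.elim ![1,2,3,7] ![0,4,5,6]
def colF : Fin 4 ⊕ Fin 4 → Fin 8 := Sum.elim ![0,2,3,4] ![1,5,6,7]
def rowG : Fin 8 → Fin 4 ⊕ Fin 4 :=
  ![.inr 0, .inl 0, .inl 1, .inl 2, .inr 1, .inr 2, .inr 3, .inl 3]
def colG : Fin 8 → Fin 4 ⊕ Fin 4 :=
  ![.inl 0, .inr 0, .inl 1, .inl 2, .inl 3, .inr 1, .inr 2, .inr 3]
def rowE : Fin 4 ⊕ Fin 4 ≃ Fin 8 := ⟨rowF, rowG, by decide, by decide⟩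
def colE : Fin 4 ⊕ Fin 4 ≃ Fin 8 := ⟨colF, colG, by decide, by decide⟩

theorem sign_rc : Equiv.Perm.sign (colE.symm.trans rowE) = 1 := by decide +kernel

theorem det_blocks (t a b x : ℂ) :
    (!![0, 0, 0, 0, 0, t*x, -(1-t)*a, -(1-t)*b;
        -t*x, 0, 0, (1-t)*a, (1-t)*b, 0, 0, 0;
        -2*(1-t)*a, 0, (1-t)*a, x, 0, 0, 0, 0;
        -2*(1-t)*b, 0, (1-t)*b, 0, x, 0, 0, 0;
        0, x, 0, 0, 0, (1-t)*x, 2*(1-t)*a, 2*(1-t)*b;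
        0, (1-t)*a, 0, 0, 0, -(1-t)*a, 2*x, 0;
        0, (1-t)*b, 0, 0, 0, -(1-t)*b, 0, 2*x;
        0, 0, x, (1-t)*a, (1-t)*b, 0, 0, 0] : Matrix (Fin 8) (Fin 8) ℂ).det
      = (matA t a b x).det * (matB t a b x).det := by
  set M : Matrix (Fin 8) (Fin 8) ℂ := _ with hM
  change M.det = _
  have h1 : (M.submatrix (colE.symm.trans rowE) id).det = M.det := by
    rw [Matrix.det_permute, sign_rc]; simp
  have h2 : (M.submatrix (colE.symm.trans rowE) id).submatrix colE colE
      = Matrix.fromBlocks (matA t a b x) 0 0 (matB t a b x) := by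
    rw [Matrix.submatrix_submatrix]
    have e1 : (colE.symm.trans rowE : Fin 8 → Fin 8) ∘ colE = rowF := by
      funext i; simp [rowE]
    rw [e1, hM]
    ext i j
    rcases i with i | i <;> rcases j with j | j <;> fin_cases i <;> fin_cases j <;> rfl
  rw [← h1, ← Matrix.det_submatrix_equiv_self colE, h2, Matrix.det_fromBlocks_zero₂₁]


/-- Along the homotopy `t ∈ [0,1]` of boundary conditions at the flat
metric, with tangential symbol variables `(ξ₂,ξ₃) ≠ (0,0)` and
`ξ₁ = i√(ξ₂²+ξ₃²)` the root of the flat interior symbol with positive imaginary part,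
the boundary symbol matrix `M_t` has determinant
`[t + (2+t)(1−t)²]·[2(2+t)(1−t)² + 4t]·(ξ₂²+ξ₃²)⁴`, a positive real number; in
particular `M_t` is invertible for every `t ∈ [0,1]`. -/
theorem stmt_6 (t : ℝ) (ht : t ∈ Set.Icc (0 : ℝ) 1) (ξ₂ ξ₃ : ℝ) (hξ : (ξ₂, ξ₃) ≠ (0, 0))
    (ξ₁ : ℂ) (hξ₁ : ξ₁ = Complex.I * (Real.sqrt (ξ₂^2 + ξ₃^2) : ℂ))
    (M : Matrix (Fin 8) (Fin 8) ℂ)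
    (hM : M = !![0, 0, 0, 0, 0, (t:ℂ)*ξ₁, -(1-(t:ℂ))*(ξ₂:ℂ), -(1-(t:ℂ))*(ξ₃:ℂ);
                 -(t:ℂ)*ξ₁, 0, 0, (1-(t:ℂ))*(ξ₂:ℂ), (1-(t:ℂ))*(ξ₃:ℂ), 0, 0, 0;
                 -2*(1-(t:ℂ))*(ξ₂:ℂ), 0, (1-(t:ℂ))*(ξ₂:ℂ), ξ₁, 0, 0, 0, 0;
                 -2*(1-(t:ℂ))*(ξ₃:ℂ), 0, (1-(t:ℂ))*(ξ₃:ℂ), 0, ξ₁, 0, 0, 0;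
                 0, ξ₁, 0, 0, 0, (1-(t:ℂ))*ξ₁, 2*(1-(t:ℂ))*(ξ₂:ℂ), 2*(1-(t:ℂ))*(ξ₃:ℂ);
                 0, (1-(t:ℂ))*(ξ₂:ℂ), 0, 0, 0, -(1-(t:ℂ))*(ξ₂:ℂ), 2*ξ₁, 0;
                 0, (1-(t:ℂ))*(ξ₃:ℂ), 0, 0, 0, -(1-(t:ℂ))*(ξ₃:ℂ), 0, 2*ξ₁;
                 0, 0, ξ₁, (1-(t:ℂ))*(ξ₂:ℂ), (1-(t:ℂ))*(ξ₃:ℂ), 0, 0, 0]) :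
    M.det = (((t + (2+t)*(1-t)^2) * (2*(2+t)*(1-t)^2 + 4*t) * (ξ₂^2+ξ₃^2)^4 : ℝ) : ℂ) ∧
      0 < (t + (2+t)*(1-t)^2) * (2*(2+t)*(1-t)^2 + 4*t) * (ξ₂^2+ξ₃^2)^4 ∧
      IsUnit M := by
  have hx : ξ₁^2 = -((ξ₂:ℂ)^2 + (ξ₃:ℂ)^2) := by
    rw [hξ₁, mul_pow, Complex.I_sq, ← Complex.ofReal_pow, Real.sq_sqrt (by positivity)]
    push_cast; ring
  have hdet : M.det = (((t + (2+t)*(1-t)^2) * (2*(2+t)*(1-t)^2 + 4*t) * (ξ₂^2+ξ₃^2)^4 : ℝ) : ℂ) := by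
    rw [hM, det_blocks]
    push_cast
    generalize (t:ℂ) = t at *
    generalize (ξ₂:ℂ) = a at *
    generalize (ξ₃:ℂ) = b at *
    rw [detA t a b ξ₁ hx, detB t a b ξ₁ hx]
    ring
  have hr : 0 < ξ₂^2 + ξ₃^2 := by
    by_contra h
    apply hξ
    have h2 : ξ₂ = 0 := by nlinarith [sq_nonneg ξ₂, sq_nonneg ξ₃]
    have h3 : ξ₃ = 0 := by nlinarith [sq_nonneg ξ₂, sq_nonneg ξ₃]
    rw [h2, h3]
  have hpos : 0 < (t + (2+t)*(1-t)^2) * (2*(2+t)*(1-t)^2 + 4*t) * (ξ₂^2+ξ₃^2)^4 := by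
    obtain ⟨h0, h1⟩ := ht
    have hA : 0 < t + (2+t)*(1-t)^2 := by
      rcases h0.eq_or_lt with h | h
      · subst h; norm_num
      · positivity
    have hB : 0 < 2*(2+t)*(1-t)^2 + 4*t := by nlinarith
    positivity
  refine ⟨hdet, hpos, ?_⟩
  rw [Matrix.isUnit_iff_isUnit_det, hdet, isUnit_iff_ne_zero]
  exact_mod_cast hpos.ne'
end

section
/- Let I ⊆ ℝ be a nonempty open interval and let (f_n)_{n ∈ ℕ} be a sequence of functions f_n : ℝ → ℝ, each real-analytic on I. Suppose that for every x ∈ I there exists some n ∈ ℕ with f_n(x) = 0. Then there exists n₀ ∈ ℕ such that f_{n₀}(x) = 0 for all x ∈ I. -/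
/-- Countable-covering principle for zero sets of real-analytic functions:
if `(f_n)` is a sequence of functions, each real-analytic on a nonempty open interval
`I ⊆ ℝ`, and every point of `I` is a zero of some `f_n`, then some `f_{n₀}` vanishes
identically on `I`. -/
theorem stmt_7 (I : Set ℝ) (hI_open : IsOpen I) (hI_ne : I.Nonempty)
    (hI_conn : I.OrdConnected) (f : ℕ → ℝ → ℝ)
    (hf : ∀ n, AnalyticOnNhd ℝ (f n) I)
    (hzero : ∀ x ∈ I, ∃ n, f n x = 0) :
    ∃ n₀, ∀ x ∈ I, f n₀ x = 0 := by
  by_contra hcon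
  have hc : ∀ n, (I ∩ {x | f n x = 0}).Countable := by
    intro n
    have key : ∀ x ∈ I ∩ {x | f n x = 0},
        ({x} : Set ℝ) ∈ nhdsWithin x (I ∩ {x | f n x = 0}) := by
      rintro x ⟨hx, -⟩
      have h1 : ¬ ∃ᶠ z in nhdsWithin x {x}ᶜ, f n z = 0 := fun h =>
        hcon ⟨n, fun y hy =>
          (hf n).eqOn_zero_of_preconnected_of_frequently_eq_zero
            hI_conn.isPreconnected hx h hy⟩
      rw [Filter.not_frequently, eventually_nhdsWithin_iff] at h1
      rw [mem_nhdsWithin_iff_eventually]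
      filter_upwards [h1] with z hz hz2
      by_contra hne
      exact hz hne hz2.2
    obtain ⟨t, -, ht, hs⟩ := TopologicalSpace.countable_cover_nhdsWithin key
    refine ht.mono ?_
    simpa using hs
  have hIc : I.Countable := (Set.countable_iUnion hc).mono fun x hx => by
    obtain ⟨n, hn⟩ := hzero x hx
    exact Set.mem_iUnion.2 ⟨n, hx, hn⟩
  exact (hI_open.measure_pos MeasureTheory.volume hI_ne).ne' (hIc.measure_zero _)
end
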